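/- arXiv:1702.02142 — 2 statements merged into one kernel-verified Lean document; each statement's English description precedes it below -/
import Mathlib

section
/- For every integer n ≥ 2, a directed edge v_i → v_j with i < j that is not an edge of →P_{2^n−1} (i.e., an added edge of type I) is admissible for →P_{2^n−1} if and only if it is an edge of the direct sum graph of type I →G_n. -/
/-- A directed graph on a subset of ℕ. -/
structure DGraph where
  verts : Set ℕ
  edges : Set (ℕ × ℕ)

/-- `l` is a directed walk in `G` from `u` to `v`. -/
def IsWalkFrom (G : DGraph) (u v : ℕ) (l : List ℕ) : Prop :=
  l.head? = some u ∧ l.getLast? = some v ∧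
    l.Chain' (fun a b => (a, b) ∈ G.edges) ∧ ∀ x ∈ l, x ∈ G.verts

/-- A `k`-ranking of `G`: labels in `{1,…,k}` and every directed path joining two
vertices with the same label contains a vertex with a larger label. -/
def IsRanking (G : DGraph) (k : ℕ) (f : ℕ → ℕ) : Prop :=
  (∀ v ∈ G.verts, 1 ≤ f v ∧ f v ≤ k) ∧
    ∀ u ∈ G.verts, ∀ v ∈ G.verts, u ≠ v → f u = f v →
      ∀ l : List ℕ, IsWalkFrom G u v l → ∃ x ∈ l, f u < f x

/-- The rank number `χ_r(G)`. -/
noncomputable def rankNumber (G : DGraph) : ℕ := sInf {k | ∃ f : ℕ → ℕ, IsRanking G k f}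

def pathEdges (η : ℕ) : Set (ℕ × ℕ) := {p | ∃ i, 1 ≤ i ∧ i + 1 ≤ η ∧ p = (i, i + 1)}

/-- The directed path `→P_η` on vertices `1,…,η`. -/
def pathP (η : ℕ) : DGraph := ⟨Set.Icc 1 η, pathEdges η⟩

/-- The directed cycle `→C_η` on vertices `1,…,η`. -/
def cycleC (η : ℕ) : DGraph := ⟨Set.Icc 1 η, pathEdges η ∪ {(η, 1)}⟩

/-- Add a single directed edge to a digraph. -/
def addEdge (G : DGraph) (e : ℕ × ℕ) : DGraph := ⟨G.verts, insert e G.edges⟩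

/-- The standard label of vertex `i`: `α + 1` where `2^α` is the largest power
of 2 dividing `i`. -/
def stdLabel (i : ℕ) : ℕ := padicValNat 2 i + 1

/-- Edge set of the direct sum graph of type I, `→G_n`. -/
def edgesI : ℕ → Set (ℕ × ℕ)
  | 0 => ∅
  | 1 => ∅
  | 2 => {(1, 2), (2, 3)}
  | n + 3 =>
      edgesI (n + 2) ∪
      (fun p : ℕ × ℕ => (p.1 + 2 ^ (n + 2), p.2 + 2 ^ (n + 2))) '' edgesI (n + 2) ∪
      {(2 ^ (n + 2) - 1, 2 ^ (n + 2)), (2 ^ (n + 2), 2 ^ (n + 2) + 1)} ∪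
      {p | ∃ j, 1 ≤ j ∧ j ≤ 2 ^ (n + 2) - 2 ∧ p = (j, 2 ^ (n + 2))} ∪
      {p | ∃ j, 2 ≤ j ∧ j ≤ 2 ^ (n + 2) - 1 ∧ p = (2 ^ (n + 2), 2 ^ (n + 2) + j)} ∪
      (fun p : ℕ × ℕ => (p.1, p.2 + 2 ^ (n + 2))) '' edgesI (n + 2)

/-- Edge set of the direct sum graph of type II, `←G_n`. -/
def edgesII : ℕ → Set (ℕ × ℕ)
  | 0 => ∅
  | 1 => ∅
  | 2 => {(1, 2), (2, 3), (2, 1), (3, 2)}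
  | n + 3 =>
      edgesII (n + 2) ∪
      (fun p : ℕ × ℕ => (p.1 + 2 ^ (n + 2), p.2 + 2 ^ (n + 2))) '' edgesII (n + 2) ∪
      {(2 ^ (n + 2) - 1, 2 ^ (n + 2)), (2 ^ (n + 2), 2 ^ (n + 2) + 1)} ∪
      {p | ∃ j, 1 ≤ j ∧ j ≤ 2 ^ (n + 2) - 1 ∧ p = (2 ^ (n + 2), j)} ∪
      {p | ∃ j, 1 ≤ j ∧ j ≤ 2 ^ (n + 2) - 1 ∧ p = (2 ^ (n + 2) + j, 2 ^ (n + 2))}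

/-- The direct sum graph of type I, `→G_n`. -/
def GI (n : ℕ) : DGraph := ⟨Set.Icc 1 (2 ^ n - 1), edgesI n⟩

/-- The direct sum graph of type II, `←G_n`. -/
def GII (n : ℕ) : DGraph := ⟨Set.Icc 1 (2 ^ n - 1), edgesII n⟩

/-- The graph `→Ω_{2^k}`. -/
def OmegaI (k : ℕ) : DGraph :=
  ⟨Set.Icc 1 (2 ^ k),
    (cycleC (2 ^ k)).edges ∪ (edgesI k \ pathEdges (2 ^ k - 1)) ∪
      {p | ∃ i, 2 ≤ i ∧ i ≤ 2 ^ k - 2 ∧ p = (2 ^ k, i)}⟩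

/-- The graph `←Ω_{2^k}`. -/
def OmegaII (k : ℕ) : DGraph :=
  ⟨Set.Icc 1 (2 ^ k),
    (cycleC (2 ^ k)).edges ∪ (edgesII k \ pathEdges (2 ^ k - 1)) ∪
      {p | ∃ i, 2 ≤ i ∧ i ≤ 2 ^ k - 2 ∧ p = (i, 2 ^ k)}⟩

/-- Stirling numbers of the second kind. -/
def stirling : ℕ → ℕ → ℕ
  | 0, 0 => 1
  | 0, _ + 1 => 0
  | _ + 1, 0 => 0
  | n + 1, k + 1 => (k + 1) * stirling n (k + 1) + stirling n k

/-- Attach the directed path `→P_j^{v_i}` (directed toward `vi`) to `G`,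
using `w 1, …, w (j-1)` as the new vertices and `vi` in place of `w j`. -/
def attachFwd (G : DGraph) (vi j : ℕ) (w : ℕ → ℕ) : DGraph :=
  ⟨G.verts ∪ w '' Set.Icc 1 (j - 1),
    G.edges ∪ {p | ∃ l, 1 ≤ l ∧ l + 1 ≤ j ∧
      p = (w l, if l + 1 = j then vi else w (l + 1))}⟩

/-- Attach the directed path `←P_j^{v_i}` (directed away from `vi`) to `G`. -/
def attachBwd (G : DGraph) (vi j : ℕ) (w : ℕ → ℕ) : DGraph :=
  ⟨G.verts ∪ w '' Set.Icc 1 (j - 1),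
    G.edges ∪ {p | ∃ l, 1 ≤ l ∧ l + 1 ≤ j ∧
      p = ((if l + 1 = j then vi else w (l + 1)), w l)}⟩

def PR (f : ℕ → ℕ) (s e : ℕ) : Prop :=
  ∀ u v, s ≤ u → u < v → v ≤ e → f u = f v → ∃ x, u ≤ x ∧ x ≤ v ∧ f u < f x

def PE (n i j : ℕ) : Prop :=
  ∀ u v, 1 ≤ u → u ≤ i → j ≤ v → v < 2 ^ n → stdLabel u = stdLabel v →
    ∃ x, ((u ≤ x ∧ x ≤ i) ∨ (j ≤ x ∧ x ≤ v)) ∧ stdLabel u < stdLabel x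

lemma PR.mono {f : ℕ → ℕ} {s e s' e' : ℕ} (h : PR f s e) (hs : s ≤ s') (he : e' ≤ e) :
    PR f s' e' := fun u v a b c d => h u v (by omega) b (by omega) d

lemma PR_LB (f : ℕ → ℕ) (k : ℕ) : ∀ s, (∀ x, s ≤ x → x < s + 2 ^ k → 1 ≤ f x ∧ f x ≤ k) →
    PR f s (s + 2 ^ k - 1) → False := by
  induction k with
  | zero =>
    intro s h _
    have := h s le_rfl (by simp)
    omega
  | succ k ih =>
    intro s h hR
    have hp : 0 < 2 ^ k := by positivity
    rw [pow_succ] at h hR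
    by_cases h1 : ∃ x, s ≤ x ∧ x < s + 2 ^ k ∧ f x = k + 1
    · obtain ⟨x, hx1, hx2, hx3⟩ := h1
      refine ih (s + 2 ^ k) ?_ (hR.mono (by omega) (by omega))
      intro y hy1 hy2
      have hy := h y (by omega) (by omega)
      refine ⟨hy.1, ?_⟩
      by_contra hc
      obtain ⟨z, hz1, hz2, hz3⟩ := hR x y hx1 (by omega) (by omega) (by omega)
      have := h z (by omega) (by omega)
      omega
    · push Not at h1
      refine ih s ?_ (hR.mono (by omega) (by omega))
      intro y hy1 hy2
      have hy := h y (by omega) (by omega)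
      have := h1 y hy1 hy2
      omega

lemma std_pow (n : ℕ) : stdLabel (2 ^ n) = n + 1 := by
  simp [stdLabel]

lemma std_lt (n x : ℕ) (h0 : 0 < x) (hx : x < 2 ^ n) : stdLabel x ≤ n := by
  unfold stdLabel
  have h1 : 2 ^ padicValNat 2 x ≤ x := Nat.le_of_dvd h0 pow_padicValNat_dvd
  have : padicValNat 2 x < n := (Nat.pow_lt_pow_iff_right (by norm_num : 1 < 2)).1 (by omega)
  omega

lemma std_add (n x : ℕ) (h0 : 0 < x) (hx : x < 2 ^ n) : stdLabel (x + 2 ^ n) = stdLabel x := by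
  unfold stdLabel
  have hl := std_lt n x h0 hx
  unfold stdLabel at hl
  congr 1
  apply le_antisymm
  · by_contra hc
    push Not at hc
    have h1 : 2 ^ (padicValNat 2 x + 1) ∣ x + 2 ^ n :=
      (pow_dvd_pow 2 hc).trans pow_padicValNat_dvd
    have h2 : 2 ^ (padicValNat 2 x + 1) ∣ 2 ^ n := pow_dvd_pow 2 hl
    have h3 := (Nat.dvd_add_left h2).1 h1
    rw [padicValNat_dvd_iff_le (by omega)] at h3
    omega
  · rw [← padicValNat_dvd_iff_le (by omega)]
    exact dvd_add pow_padicValNat_dvd (pow_dvd_pow 2 (by omega))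

lemma std_pos (x : ℕ) : 1 ≤ stdLabel x := by simp [stdLabel]

lemma PR_uniq (f : ℕ → ℕ) (k : ℕ) : ∀ s, (∀ x, s < x → x < s + 2 ^ k → 1 ≤ f x ∧ f x ≤ k) →
    PR f (s + 1) (s + 2 ^ k - 1) → ∀ x, 0 < x → x < 2 ^ k → f (s + x) = stdLabel x := by
  induction k with
  | zero =>
    intro s h _ x h0 hx
    simp at hx; omega
  | succ k ih =>
    intro s h hR
    have hp : 0 < 2 ^ k := by positivity
    rw [pow_succ] at h hR ⊢
    -- some vertex in left block of length 2^k has max label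
    have hL : ∃ x, s + 1 ≤ x ∧ x < s + 1 + 2 ^ k ∧ f x = k + 1 := by
      by_contra hc
      push Not at hc
      refine PR_LB f k (s + 1) ?_ (hR.mono (by omega) (by omega))
      intro y hy1 hy2
      have hy := h y (by omega) (by omega)
      have := hc y hy1 hy2
      omega
    have hRr : ∃ x, s + 2 ^ k ≤ x ∧ x < s + 2 ^ k + 2 ^ k ∧ f x = k + 1 := by
      by_contra hc
      push Not at hc
      refine PR_LB f k (s + 2 ^ k) ?_ (hR.mono (by omega) (by omega))
      intro y hy1 hy2
      have hy := h y (by omega) (by omega)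
      have := hc y hy1 hy2
      omega
    obtain ⟨x, hx1, hx2, hx3⟩ := hL
    obtain ⟨y, hy1, hy2, hy3⟩ := hRr
    have huniq : ∀ a b, s + 1 ≤ a → a < b → b < s + 2 ^ k * 2 → f a = k + 1 → f b = k + 1 →
        False := by
      intro a b h1 h2 h3 h4 h5
      obtain ⟨z, hz1, hz2, hz3⟩ := hR a b h1 h2 (by omega) (by omega)
      have := h z (by omega) (by omega)
      omega
    have hxy : x = y := by
      by_contra hc
      rcases Nat.lt_or_ge x y with h1 | h1
      · exact huniq x y (by omega) h1 (by omega) hx3 hy3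
      · exact huniq y x (by omega) (by omega) (by omega) hy3 hx3
    have hM : x = s + 2 ^ k := by omega
    subst hM
    intro t ht0 ht
    rcases Nat.lt_trichotomy t (2 ^ k) with h1 | h1 | h1
    · refine ih s ?_ (hR.mono (by omega) (by omega)) t ht0 h1
      intro z hz1 hz2
      have := h z (by omega) (by omega)
      have : f z ≠ k + 1 := fun e => huniq z _ (by omega) hz2 (by omega) e hx3
      omega
    · subst h1
      rw [std_pow, hx3]
    · have e := ih (s + 2 ^ k) ?_ (hR.mono (by omega) (by omega)) (t - 2 ^ k)
        (by omega) (by omega)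
      · rw [← std_add k (t - 2 ^ k) (by omega) (by omega)] at e
        rw [show s + 2 ^ k + (t - 2 ^ k) = s + t by omega,
          show t - 2 ^ k + 2 ^ k = t by omega] at e
        exact e
      · intro z hz1 hz2
        have := h z (by omega) (by omega)
        have : f z ≠ k + 1 := fun e => huniq _ z (by omega) hz1 (by omega) hx3 e
        omega

lemma std_PR (k : ℕ) : PR stdLabel 1 (2 ^ k - 1) := by
  induction k with
  | zero => intro u v h1 h2 h3 _; simp at h3; omega
  | succ k ih =>
    intro u v h1 h2 h3 h4
    have hp : 0 < 2 ^ k := by positivity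
    rw [pow_succ] at h3
    rcases Nat.lt_trichotomy v (2 ^ k) with h | h | h
    · exact ih u v h1 h2 (by omega) h4
    · have := std_lt k u h1 (by omega)
      subst h
      rw [std_pow] at h4
      omega
    · have e := std_add k (v - 2 ^ k) (by omega) (by omega)
      have e' := std_lt k (v - 2 ^ k) (by omega) (by omega)
      rw [show v - 2 ^ k + 2 ^ k = v by omega] at e
      by_cases hu : u ≤ 2 ^ k
      · refine ⟨2 ^ k, hu, h.le, ?_⟩
        rw [std_pow]; omega
      · have d := std_add k (u - 2 ^ k) (by omega) (by omega)
        rw [show u - 2 ^ k + 2 ^ k = u by omega] at d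
        obtain ⟨x, hx1, hx2, hx3⟩ := ih (u - 2 ^ k) (v - 2 ^ k) (by omega) (by omega) (by omega)
          (by omega)
        refine ⟨x + 2 ^ k, by omega, by omega, ?_⟩
        rw [std_add k x (by omega) (by omega)]
        omega

lemma edges_range (n : ℕ) : ∀ i j, (i, j) ∈ edgesI (n + 2) →
    1 ≤ i ∧ i < 2 ^ (n + 2) ∧ 1 ≤ j ∧ j < 2 ^ (n + 2) := by
  induction n with
  | zero =>
    intro i j h
    simp [edgesI] at h
    omega
  | succ n ih =>
    intro i j h
    have hp : 1 < 2 ^ (n + 2) := Nat.one_lt_two_pow (by omega)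
    rw [show n + 1 + 2 = (n + 2) + 1 by ring, pow_succ]
    simp only [edgesI, Set.mem_union, Set.mem_image, Set.mem_setOf_eq, Prod.exists,
      Prod.mk.injEq, Set.mem_insert_iff, Set.mem_singleton_iff] at h
    rcases h with ((((h | ⟨a, b, h, h1, h2⟩) | h) | ⟨a, h⟩) | ⟨a, h⟩) | ⟨a, b, h, h1, h2⟩
    · have := ih _ _ h; omega
    · have := ih _ _ h; omega
    · omega
    · omega
    · omega
    · have := ih _ _ h; omega

lemma edges_succ (n i j : ℕ) : (i, j) ∈ edgesI (n + 3) ↔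
    ((i, j) ∈ edgesI (n + 2) ∨
     (2 ^ (n + 2) < i ∧ 2 ^ (n + 2) < j ∧ (i - 2 ^ (n + 2), j - 2 ^ (n + 2)) ∈ edgesI (n + 2)) ∨
     (i = 2 ^ (n + 2) ∧ 2 ^ (n + 2) < j ∧ j < 2 ^ (n + 2) * 2) ∨
     (j = 2 ^ (n + 2) ∧ 1 ≤ i ∧ i < 2 ^ (n + 2)) ∨
     (2 ^ (n + 2) < j ∧ (i, j - 2 ^ (n + 2)) ∈ edgesI (n + 2))) := by
  have hp : 1 < 2 ^ (n + 2) := Nat.one_lt_two_pow (by omega)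
  have hp : 3 < 2 ^ (n + 2) := by rw [pow_add]; have : 0 < 2 ^ n := by positivity
                                  omega
  simp only [edgesI, Set.mem_union, Set.mem_image, Set.mem_setOf_eq, Prod.exists,
      Prod.mk.injEq, Set.mem_insert_iff, Set.mem_singleton_iff]
  constructor
  · rintro (((((h | ⟨a, b, h, h1, h2⟩) | h) | ⟨a, h⟩) | ⟨a, h⟩) | ⟨a, b, h, h1, h2⟩)
    · exact Or.inl h
    · have := edges_range _ _ _ h
      right; left
      subst h1 h2
      refine ⟨by omega, by omega, ?_⟩
      simpa using h
    · right; right; omega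
    · right; right; omega
    · right; right; omega
    · have := edges_range _ _ _ h
      right; right; right; right
      subst h1 h2
      refine ⟨by omega, ?_⟩
      simpa using h
  · rintro (h | ⟨h1, h2, h⟩ | h | h | ⟨h1, h⟩)
    · left; left; left; left; left; exact h
    · left; left; left; left; right
      exact ⟨_, _, h, by omega, by omega⟩
    · by_cases hj : j = 2 ^ (n + 2) + 1
      · left; left; left; right; omega
      · left; right
        exact ⟨j - 2 ^ (n + 2), by omega⟩
    · by_cases hj : i = 2 ^ (n + 2) - 1
      · left; left; left; right; omega
      · left; left; right
        exact ⟨i, by omega⟩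
    · right
      exact ⟨_, _, h, rfl, by omega⟩

section
variable (n i j : ℕ)

lemma PE_ll (hi : 1 ≤ i) (hi2 : i < 2 ^ n) (hj : 1 ≤ j) (hj2 : j < 2 ^ n) :
    PE (n + 1) i j ↔ PE n i j := by
  constructor
  · intro h u v h1 h2 h3 h4 h5
    exact h u v h1 h2 h3 (by rw [pow_succ]; omega) h5
  · intro h u v h1 h2 h3 h4 h5
    have := std_lt n u h1 (by omega)
    rcases Nat.lt_or_ge v (2 ^ n) with hv | hv
    · exact h u v h1 h2 h3 hv h5
    · exact ⟨2 ^ n, Or.inr ⟨by omega, hv⟩, by rw [std_pow]; omega⟩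

lemma std_sub (x : ℕ) (h : 2 ^ n < x) (h' : x < 2 ^ n * 2) :
    stdLabel x = stdLabel (x - 2 ^ n) := by
  have e := std_add n (x - 2 ^ n) (by omega) (by omega)
  rwa [show x - 2 ^ n + 2 ^ n = x by omega] at e

lemma PE_lr (hi : 1 ≤ i) (hi2 : i < 2 ^ n) (hj : 2 ^ n < j) (hj2 : j < 2 ^ n * 2) :
    PE (n + 1) i j ↔ PE n i (j - 2 ^ n) := by
  constructor
  · intro h u v h1 h2 h3 h4 h5
    have e := std_add n v (by omega) h4
    obtain ⟨x, hx, hx2⟩ := h u (v + 2 ^ n) h1 h2 (by omega) (by rw [pow_succ]; omega) (by omega)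
    rcases hx with hx | hx
    · exact ⟨x, Or.inl hx, hx2⟩
    · refine ⟨x - 2 ^ n, Or.inr (by omega), ?_⟩
      rwa [← std_sub n x (by omega) (by omega)]
  · intro h u v h1 h2 h3 h4 h5
    rw [pow_succ] at h4
    have e := std_sub n v (by omega) (by omega)
    obtain ⟨x, hx, hx2⟩ := h u (v - 2 ^ n) h1 h2 (by omega) (by omega) (by omega)
    rcases hx with hx | hx
    · exact ⟨x, Or.inl hx, hx2⟩
    · refine ⟨x + 2 ^ n, Or.inr (by omega), ?_⟩
      rwa [std_add n x (by omega) (by omega)]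

lemma PE_rr (hi : 2 ^ n < i) (hi2 : i < 2 ^ n * 2) (hj : 2 ^ n < j) (hj2 : j < 2 ^ n * 2) :
    PE (n + 1) i j ↔ PE n (i - 2 ^ n) (j - 2 ^ n) := by
  constructor
  · intro h u v h1 h2 h3 h4 h5
    have e := std_add n v (by omega) h4
    have e' := std_add n u (by omega) (by omega)
    obtain ⟨x, hx, hx2⟩ := h (u + 2 ^ n) (v + 2 ^ n) (by omega) (by omega) (by omega)
      (by rw [pow_succ]; omega) (by omega)
    refine ⟨x - 2 ^ n, by omega, ?_⟩
    rwa [← std_sub n x (by omega) (by omega), ← e']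
  · intro h u v h1 h2 h3 h4 h5
    rw [pow_succ] at h4
    have e := std_sub n v (by omega) (by omega)
    have el := std_lt n (v - 2 ^ n) (by omega) (by omega)
    by_cases hu : u ≤ 2 ^ n
    · exact ⟨2 ^ n, Or.inl (by omega), by rw [std_pow]; omega⟩
    have e' := std_sub n u (by omega) (by omega)
    obtain ⟨x, hx, hx2⟩ := h (u - 2 ^ n) (v - 2 ^ n) (by omega) (by omega) (by omega)
      (by omega) (by omega)
    refine ⟨x + 2 ^ n, by omega, ?_⟩
    rwa [std_add n x (by omega) (by omega), e']

lemma std_le_top (x : ℕ) (h : 1 ≤ x) (h' : x < 2 ^ n * 2) : stdLabel x ≤ n + 1 :=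
  std_lt (n + 1) x h (by rw [pow_succ]; omega)

lemma PE_rl (hi : 2 ^ n ≤ i) (hi2 : i < 2 ^ n * 2) (hj : 1 ≤ j) (hj2 : j ≤ 2 ^ n) :
    ¬ PE (n + 1) i j := by
  intro h
  have hp : 0 < 2 ^ n := by positivity
  obtain ⟨x, hx, hx2⟩ := h (2 ^ n) (2 ^ n) (by omega) hi hj2 (by rw [pow_succ]; omega) rfl
  rw [std_pow] at hx2
  have := std_le_top n x (by omega) (by omega)
  omega

lemma PE_mr (hj : 2 ^ n < j) : PE (n + 1) (2 ^ n) j := by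
  intro u v h1 h2 h3 h4 h5
  rw [pow_succ] at h4
  have e := std_sub n v (by omega) (by omega)
  have el := std_lt n (v - 2 ^ n) (by omega) (by omega)
  exact ⟨2 ^ n, Or.inl (by omega), by rw [std_pow]; omega⟩

lemma PE_lm (hi2 : i < 2 ^ n) : PE (n + 1) i (2 ^ n) := by
  intro u v h1 h2 h3 h4 h5
  have el := std_lt n u (by omega) (by omega)
  exact ⟨2 ^ n, Or.inr (by omega), by rw [std_pow]; omega⟩
end

lemma not_PE_one : ¬ PE 1 1 1 := by
  intro h
  obtain ⟨x, hx, hx2⟩ := h 1 1 (by omega) (by omega) (by omega) (by norm_num) rfl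
  have : x = 1 := by omega
  subst this; omega

set_option maxHeartbeats 1000000 in
lemma PE_iff (n : ℕ) : ∀ i j, 1 ≤ i → i < 2 ^ (n + 2) → 1 ≤ j → j < 2 ^ (n + 2) →
    (PE (n + 2) i j ↔ (i, j) ∈ edgesI (n + 2)) := by
  induction n with
  | zero =>
    intro i j hi hi2 hj hj2
    norm_num at hi2 hj2
    simp only [edgesI, Set.mem_insert_iff, Set.mem_singleton_iff, Prod.mk.injEq]
    rcases Nat.lt_trichotomy i 2 with h | h | h <;> rcases Nat.lt_trichotomy j 2 with h' | h' | h'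
    · obtain rfl : i = 1 := by omega
      obtain rfl : j = 1 := by omega
      rw [PE_ll 1 1 1 (by omega) (by omega) (by omega) (by omega)]
      simp [not_PE_one]
    · have := PE_lm 1 i (by omega)
      subst h'
      exact iff_of_true this (by omega)
    · obtain rfl : i = 1 := by omega
      obtain rfl : j = 3 := by omega
      rw [PE_lr 1 1 3 (by omega) (by omega) (by omega) (by omega)]
      simp [not_PE_one]
    · have := PE_rl 1 i j (by omega) (by omega) (by omega) (by omega)
      simp only [Nat.zero_add, this, false_iff]; omega
    · have := PE_rl 1 i j (by omega) (by omega) (by omega) (by omega)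
      simp only [Nat.zero_add, this, false_iff]; omega
    · have := PE_mr 1 j (by omega)
      subst h
      exact iff_of_true this (by omega)
    · have := PE_rl 1 i j (by omega) (by omega) (by omega) (by omega)
      simp only [Nat.zero_add, this, false_iff]; omega
    · have := PE_rl 1 i j (by omega) (by omega) (by omega) (by omega)
      simp only [Nat.zero_add, this, false_iff]; omega
    · obtain rfl : i = 3 := by omega
      obtain rfl : j = 3 := by omega
      rw [PE_rr 1 3 3 (by omega) (by omega) (by omega) (by omega)]
      simp [not_PE_one]
  | succ n ih =>
    intro i j hi hi2 hj hj2
    rw [show n + 1 + 2 = (n + 2) + 1 by ring, pow_succ] at hi2 hj2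
    have r1 := edges_range n i j
    have r2 := edges_range n (i - 2 ^ (n + 2)) (j - 2 ^ (n + 2))
    have r3 := edges_range n i (j - 2 ^ (n + 2))
    have es := edges_succ n i j
    rw [show n + 1 + 2 = (n + 2) + 1 by ring]
    rw [show n + 2 + 1 = n + 3 by ring, es]
    rw [show n + 3 = n + 2 + 1 by ring]
    generalize hM : 2 ^ (n + 2) = M at *
    rcases Nat.lt_trichotomy i M with h | h | h <;> rcases Nat.lt_trichotomy j M with h' | h' | h'
    · rw [PE_ll (n + 2) i j (by omega) (by omega) (by omega) (by omega),
        ih i j (by omega) (by omega) (by omega) (by omega)]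
      constructor
      · intro e; exact Or.inl e
      · rintro (e | ⟨a, b, e⟩ | e | e | ⟨a, e⟩)
        · first | exact e | (have := r1 e; omega)
        · first | exact e | omega
        · omega
        · omega
        · first | exact e | omega | (have := r3 e; omega)
    · have := PE_lm (n + 2) i (by omega)
      rw [hM, ← h'] at this
      simp only [this, true_iff]
      omega
    · rw [PE_lr (n + 2) i j (by omega) (by omega) (by omega) (by omega), hM,
        ih i (j - M) (by omega) (by omega) (by omega) (by omega)]
      constructor
      · intro e; exact Or.inr (Or.inr (Or.inr (Or.inr ⟨h', e⟩)))
      · rintro (e | ⟨a, b, e⟩ | e | e | ⟨a, e⟩)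
        · first | exact e | (have := r1 e; omega)
        · first | exact e | omega
        · omega
        · omega
        · first | exact e | omega | (have := r3 e; omega)
    · have := PE_rl (n + 2) i j (by omega) (by omega) (by omega) (by omega)
      simp only [this, false_iff]
      rintro (e | ⟨a, b, e⟩ | e | e | ⟨a, e⟩)
      · have := r1 e; omega
      · omega
      · omega
      · omega
      · omega
    · have := PE_rl (n + 2) i j (by omega) (by omega) (by omega) (by omega)
      simp only [this, false_iff]
      rintro (e | ⟨a, b, e⟩ | e | e | ⟨a, e⟩)
      · have := r1 e; omega
      · omega
      · omega
      · omega
      · omega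
    · have := PE_mr (n + 2) j (by omega)
      rw [hM, ← h] at this
      simp only [this, true_iff]
      omega
    · have := PE_rl (n + 2) i j (by omega) (by omega) (by omega) (by omega)
      simp only [this, false_iff]
      rintro (e | ⟨a, b, e⟩ | e | e | ⟨a, e⟩)
      · have := r1 e; omega
      · omega
      · omega
      · omega
      · omega
    · have := PE_rl (n + 2) i j (by omega) (by omega) (by omega) (by omega)
      simp only [this, false_iff]
      rintro (e | ⟨a, b, e⟩ | e | e | ⟨a, e⟩)
      · have := r1 e; omega
      · omega
      · omega
      · omega
      · omega
    · rw [PE_rr (n + 2) i j (by omega) (by omega) (by omega) (by omega), hM,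
        ih (i - M) (j - M) (by omega) (by omega) (by omega) (by omega)]
      constructor
      · intro e; exact Or.inr (Or.inl ⟨h, h', e⟩)
      · rintro (e | ⟨a, b, e⟩ | e | e | ⟨a, e⟩)
        · first | exact e | (have := r1 e; omega)
        · first | exact e | omega
        · omega
        · omega
        · first | exact e | omega | (have := r3 e; omega)

lemma walk_cover (i j v : ℕ) (hij : i < j) (l : List ℕ) : ∀ u, l.head? = some u →
    l.getLast? = some v → l.IsChain (fun a b => b = a + 1 ∨ (a = i ∧ b = j)) →
    u ≤ v ∧ ((∀ x, u ≤ x → x ≤ v → x ∈ l) ∨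
      (u ≤ i ∧ j ≤ v ∧ ∀ x, ((u ≤ x ∧ x ≤ i) ∨ (j ≤ x ∧ x ≤ v)) → x ∈ l)) := by
  induction l with
  | nil => intro u h; simp at h
  | cons a t ih =>
    intro u h1 h2 h3
    simp at h1
    subst h1
    cases t with
    | nil =>
      simp at h2
      subst h2
      refine ⟨le_rfl, Or.inl fun x h h' => ?_⟩
      simp; omega
    | cons b t =>
      rw [List.isChain_cons_cons] at h3
      rw [List.getLast?_cons_cons] at h2
      obtain ⟨h4, h5⟩ := ih b rfl h2 h3.2
      have hm : ∀ x, x ∈ a :: b :: t ↔ x = a ∨ x ∈ b :: t := fun x => List.mem_cons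
      refine ⟨by omega, ?_⟩
      rcases h3.1 with h6 | ⟨h6, h7⟩
      · rcases h5 with h5 | ⟨h8, h9, h5⟩
        · left
          intro x hx hx'
          rw [hm]
          by_cases e : x = a
          · exact Or.inl e
          · exact Or.inr (h5 x (by omega) hx')
        · right
          refine ⟨by omega, h9, fun x hx => ?_⟩
          rw [hm]
          by_cases e : x = a
          · exact Or.inl e
          · exact Or.inr (h5 x (by omega))
      · rcases h5 with h5 | ⟨h8, h9, h5⟩
        · right
          refine ⟨by omega, by omega, fun x hx => ?_⟩
          rw [hm]
          by_cases e : x = a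
          · exact Or.inl e
          · exact Or.inr (h5 x (by omega) (by omega))
        · omega

lemma path_walk (G : DGraph) (N : ℕ) (hV : G.verts = Set.Icc 1 N) (hE : pathEdges N ⊆ G.edges)
    (u d : ℕ) : 1 ≤ u → u + d ≤ N → IsWalkFrom G u (u + d) (List.range' u (d + 1)) := by
  intro hu hd
  refine ⟨by simp [List.range'_succ], ?_, ?_, ?_⟩
  · rw [List.range'_concat]; simp
  · show List.IsChain _ _
    rw [List.isChain_iff_getElem]
    intro k hk
    simp at hk
    apply hE
    refine ⟨u + k, by omega, by omega, ?_⟩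
    simp; omega
  · intro x hx
    rw [List.mem_range'_1] at hx
    rw [hV]
    exact ⟨by omega, by omega⟩

lemma jump_walk (G : DGraph) (N : ℕ) (hV : G.verts = Set.Icc 1 N) (hE : pathEdges N ⊆ G.edges)
    (i j : ℕ) (he : (i, j) ∈ G.edges) (u v : ℕ) (hu : 1 ≤ u) (hui : u ≤ i) (hi : i ≤ N)
    (hj : 1 ≤ j) (hjv : j ≤ v) (hv : v ≤ N) :
    IsWalkFrom G u v (List.range' u (i - u + 1) ++ List.range' j (v - j + 1)) := by
  obtain ⟨a1, a2, a3, a4⟩ := path_walk G N hV hE u (i - u) hu (by omega)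
  obtain ⟨b1, b2, b3, b4⟩ := path_walk G N hV hE j (v - j) hj (by omega)
  rw [show u + (i - u) = i by omega] at a2
  rw [show j + (v - j) = v by omega] at b2
  refine ⟨?_, ?_, ?_, ?_⟩
  · rw [List.head?_append, a1]; rfl
  · rw [List.getLast?_append, b2]; rfl
  · show List.IsChain _ _
    rw [List.isChain_append]
    refine ⟨a3, b3, ?_⟩
    intro x hx y hy
    rw [a2] at hx
    rw [b1] at hy
    simp at hx hy
    subst hx hy
    exact he
  · intro x hx
    rcases List.mem_append.1 hx with h | h
    · exact a4 x h
    · exact b4 x h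

lemma ranking_PR (G : DGraph) (N : ℕ) (hV : G.verts = Set.Icc 1 N) (hE : pathEdges N ⊆ G.edges)
    (k : ℕ) (f : ℕ → ℕ) (hf : IsRanking G k f) : PR f 1 N := by
  intro u v h1 h2 h3 h4
  have hw := path_walk G N hV hE u (v - u) h1 (by omega)
  rw [show u + (v - u) = v by omega] at hw
  obtain ⟨x, hx, hx2⟩ := hf.2 u (by rw [hV]; exact ⟨h1, by omega⟩) v
    (by rw [hV]; exact ⟨by omega, h3⟩) (by omega) h4 _ hw
  rw [List.mem_range'_1] at hx
  exact ⟨x, by omega, by omega, hx2⟩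

lemma ranking_lb (G : DGraph) (n : ℕ) (hn : 1 ≤ n) (hV : G.verts = Set.Icc 1 (2 ^ n - 1))
    (hE : pathEdges (2 ^ n - 1) ⊆ G.edges)
    (k : ℕ) (f : ℕ → ℕ) (hf : IsRanking G k f) : n ≤ k := by
  by_contra hc
  have h := ranking_PR G _ hV hE k f hf
  have hp : 2 ^ (k + 1) ≤ 2 ^ n := Nat.pow_le_pow_right (by omega) (by omega)
  have hp' : 0 < 2 ^ k := by positivity
  rw [pow_succ] at hp
  refine PR_LB f k 1 ?_ (h.mono le_rfl (by omega))
  intro x h1 h2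
  exact hf.1 x (by rw [hV]; exact ⟨h1, by omega⟩)

lemma rank_iff (G : DGraph) (n : ℕ) (hn : 1 ≤ n) (hV : G.verts = Set.Icc 1 (2 ^ n - 1))
    (hE : pathEdges (2 ^ n - 1) ⊆ G.edges) :
    rankNumber G = n ↔ ∃ f, IsRanking G n f := by
  constructor
  · intro h
    have hne : {k | ∃ f : ℕ → ℕ, IsRanking G k f}.Nonempty := by
      by_contra hc
      rw [Set.not_nonempty_iff_eq_empty] at hc
      rw [rankNumber, hc] at h
      simp at h; omega
    have := Nat.sInf_mem hne
    rw [rankNumber] at h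
    rw [h] at this
    exact this
  · rintro ⟨f, hf⟩
    apply le_antisymm
    · exact Nat.sInf_le ⟨f, hf⟩
    · obtain ⟨g, hg⟩ := Nat.sInf_mem (s := {k | ∃ f : ℕ → ℕ, IsRanking G k f}) ⟨n, f, hf⟩
      exact ranking_lb G n hn hV hE _ g hg

lemma std_ranking (G : DGraph) (n i j : ℕ) (hV : G.verts = Set.Icc 1 (2 ^ n - 1)) (hij : i < j)
    (hE : ∀ a b, (a, b) ∈ G.edges → b = a + 1 ∨ (a = i ∧ b = j))
    (h : PE n i j) : IsRanking G n stdLabel := by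
  have hp : 0 < 2 ^ n := by positivity
  constructor
  · intro v hv
    rw [hV] at hv
    obtain ⟨h1, h2⟩ := hv
    exact ⟨std_pos v, std_lt n v h1 (by omega)⟩
  · intro u hu v hv huv he l ⟨w1, w2, w3, w4⟩
    rw [hV] at hu hv
    obtain ⟨h1, h2⟩ := hu
    obtain ⟨h3, h4⟩ := hv
    obtain ⟨hle, hc⟩ := walk_cover i j v hij l u w1 w2 (List.IsChain.imp (fun a b => hE a b) w3)
    rcases hc with hc | ⟨h5, h6, hc⟩
    · obtain ⟨x, hx1, hx2, hx3⟩ := std_PR n u v h1 (by omega) h4 he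
      exact ⟨x, hc x hx1 hx2, hx3⟩
    · obtain ⟨x, hx1, hx2⟩ := h u v h1 h5 h6 (by omega) he
      exact ⟨x, hc x hx1, hx2⟩

/-- For `n ≥ 2`, an added edge `v_i → v_j` with `i < j` not in
`→P_{2^n−1}` is admissible for `→P_{2^n−1}` iff it is an edge of `→G_n`. -/
theorem stmt_4 (n : ℕ) (hn : 2 ≤ n) (i j : ℕ) (hi : 1 ≤ i) (hij : i < j)
    (hj : j ≤ 2 ^ n - 1) (hnotP : (i, j) ∉ (pathP (2 ^ n - 1)).edges) :
    rankNumber (addEdge (pathP (2 ^ n - 1)) (i, j)) = rankNumber (pathP (2 ^ n - 1)) ↔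
      (i, j) ∈ edgesI n := by
  have hp : 0 < 2 ^ n := by positivity
  have hP : rankNumber (pathP (2 ^ n - 1)) = n := by
    rw [rank_iff (pathP (2 ^ n - 1)) n (by omega) rfl (fun _ h => h)]
    refine ⟨stdLabel, std_ranking _ n 0 1 rfl (by omega) ?_ ?_⟩
    · rintro a b ⟨c, _, _, h⟩
      simp at h
      omega
    · intro u v h1 h2
      omega
  rw [hP, rank_iff (addEdge (pathP (2 ^ n - 1)) (i, j)) n (by omega) rfl
    (fun _ h => Set.mem_insert_of_mem _ h)]
  obtain ⟨m, rfl⟩ : ∃ m, n = m + 2 := ⟨n - 2, by omega⟩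
  rw [← PE_iff m i j hi (by omega) (by omega) (by omega)]
  constructor
  · rintro ⟨f, hf⟩
    have hE : pathEdges (2 ^ (m + 2) - 1) ⊆ (addEdge (pathP (2 ^ (m + 2) - 1)) (i, j)).edges :=
      fun _ h => Set.mem_insert_of_mem _ h
    have hR := ranking_PR _ (2 ^ (m + 2) - 1) rfl hE _ f hf
    have hu : ∀ x, 1 ≤ x → x < 2 ^ (m + 2) → f x = stdLabel x := by
      intro x h1 h2
      have := PR_uniq f (m + 2) 0 (fun x h h' => hf.1 x ⟨h, by omega⟩)
        (hR.mono (by omega) (by omega)) x h1 h2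
      simpa using this
    intro u v h1 h2 h3 h4 h5
    rw [← hu u (by omega) (by omega), ← hu v (by omega) (by omega)] at h5
    obtain ⟨x, hx, hx2⟩ := hf.2 u ⟨h1, by omega⟩ v ⟨by omega, by omega⟩ (by omega) h5 _
      (jump_walk _ (2 ^ (m + 2) - 1) rfl hE i j (Set.mem_insert _ _) u v h1 h2 (by omega)
        (by omega) h3 (by omega))
    rw [List.mem_append, List.mem_range'_1, List.mem_range'_1] at hx
    refine ⟨x, by omega, ?_⟩
    rwa [← hu u (by omega) (by omega), ← hu x (by omega) (by omega)]
  · intro h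
    refine ⟨stdLabel, std_ranking _ _ i j rfl hij ?_ h⟩
    rintro a b (h | ⟨c, _, _, h⟩)
    · simp at h
      omega
    · simp at h
      omega
end

section
/- For every integer n ≥ 2, the direct sum graph of type II satisfies χ_r(←G_n) = χ_r(→P_{2^n−1}) = n, and ←G_n has a unique minimal ranking; this minimal ranking coincides with the unique minimal ranking of →P_{2^n−1}, i.e., f(v_i) = α + 1 where 2^α is the largest power of 2 dividing i. -/
lemma aux_std_le (a c : ℕ) (ha : a ≠ 0) : stdLabel a ≤ c ↔ ¬ 2 ^ c ∣ a := by
  unfold stdLabel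
  rw [padicValNat_dvd_iff_le ha]
  omega

lemma aux_std_shift (m i : ℕ) (h1 : 1 ≤ i) (h2 : i < 2 ^ m) :
    stdLabel (2 ^ m + i) = stdLabel i := by
  have key : ∀ c, stdLabel (2 ^ m + i) ≤ c ↔ stdLabel i ≤ c := by
    intro c
    rw [aux_std_le _ _ (by omega), aux_std_le _ _ (by omega)]
    rcases le_or_gt c m with h | h
    · rw [Nat.dvd_add_right (pow_dvd_pow 2 h)]
    · have : 2 ^ (m + 1) ≤ 2 ^ c := Nat.pow_le_pow_right (by norm_num) h
      rw [pow_succ] at this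
      constructor
      · intro _ hd
        have := Nat.le_of_dvd (by omega) hd
        omega
      · intro _ hd
        have := Nat.le_of_dvd (by omega) hd
        omega
  exact le_antisymm ((key _).2 le_rfl) ((key _).1 le_rfl)

lemma aux_std_pow (m : ℕ) : stdLabel (2 ^ m) = m + 1 := by
  simp [stdLabel]

lemma aux_path (n : ℕ) : ∀ (a L : ℕ) (f : ℕ → ℕ),
    (∀ i, 1 ≤ i → i ≤ L → 1 ≤ f (a + i) ∧ f (a + i) ≤ n) →
    (∀ i j, 1 ≤ i → i < j → j ≤ L → f (a + i) = f (a + j) →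
      ∃ x, i ≤ x ∧ x ≤ j ∧ f (a + i) < f (a + x)) →
    L + 1 ≤ 2 ^ n ∧ (L + 1 = 2 ^ n → ∀ i, 1 ≤ i → i ≤ L → f (a + i) = stdLabel i) := by
  induction n with
  | zero =>
    intro a L f h1 h2
    have : L = 0 := by
      by_contra h
      have := h1 1 le_rfl (by omega)
      omega
    subst this
    simp
    omega
  | succ n ih =>
    intro a L f h1 h2
    have hp : 2 ^ (n + 1) = 2 ^ n + 2 ^ n := by ring
    have hpos : 0 < 2 ^ n := by positivity
    by_cases hex : ∃ p, 1 ≤ p ∧ p ≤ L ∧ f (a + p) = n + 1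
    · obtain ⟨p, hp1, hpL, hfp⟩ := hex
      have huniq : ∀ q, 1 ≤ q → q ≤ L → q ≠ p → f (a + q) ≤ n := by
        intro q hq1 hqL hne
        have hb := h1 q hq1 hqL
        by_contra hlt
        have hq : f (a + q) = n + 1 := by omega
        rcases lt_or_gt_of_ne hne with h | h
        · obtain ⟨x, hx1, hx2, hx⟩ := h2 q p hq1 h hpL (by omega)
          have := h1 x (by omega) (by omega)
          omega
        · obtain ⟨x, hx1, hx2, hx⟩ := h2 p q hp1 h hqL (by omega)
          have := h1 x (by omega) (by omega)
          omega
      have hl := ih a (p - 1) f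
        (fun i hi hi' => ⟨(h1 i hi (by omega)).1, huniq i hi (by omega) (by omega)⟩)
        (fun i j hi hij hj he => h2 i j hi hij (by omega) he)
      have hr := ih (a + p) (L - p) f
        (fun i hi hi' => by
          rw [add_assoc]
          exact ⟨(h1 (p + i) (by omega) (by omega)).1,
            huniq (p + i) (by omega) (by omega) (by omega)⟩)
        (fun i j hi hij hj he => by
          rw [add_assoc, add_assoc] at he
          obtain ⟨x, hx1, hx2, hx⟩ :=
            h2 (p + i) (p + j) (by omega) (by omega) (by omega) he
          refine ⟨x - p, by omega, by omega, ?_⟩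
          rw [add_assoc, add_assoc, Nat.add_sub_cancel' (by omega)]
          exact hx)
      refine ⟨by omega, fun hL i hi hiL => ?_⟩
      have hpe : p = 2 ^ n := by omega
      rcases lt_trichotomy i p with h | h | h
      · exact hl.2 (by omega) i hi (by omega)
      · rw [h, hfp, hpe, aux_std_pow]
      · have := hr.2 (by omega) (i - p) (by omega) (by omega)
        rw [add_assoc, Nat.add_sub_cancel' (by omega)] at this
        rw [this, ← aux_std_shift n (i - p) (by omega) (by omega), ← hpe,
          Nat.add_sub_cancel' (by omega)]
    · have := ih a L f (fun i hi hi' => by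
        have hb := h1 i hi hi'
        refine ⟨hb.1, ?_⟩
        by_contra h
        exact hex ⟨i, hi, hi', by omega⟩) h2
      refine ⟨by omega, fun _ => by omega⟩

lemma aux_edges (n : ℕ) (hn : 2 ≤ n) : ∀ a b : ℕ, (a, b) ∈ edgesII n →
    1 ≤ a ∧ a < 2 ^ n ∧ 1 ≤ b ∧ b < 2 ^ n ∧
    ∀ c, ¬ 2 ^ c ∣ a → ¬ 2 ^ c ∣ b → a / 2 ^ c = b / 2 ^ c := by
  induction n, hn using Nat.le_induction with
  | base =>
    intro a b h
    have h' : (a = 1 ∨ a = 2 ∨ a = 3) ∧ (b = 1 ∨ b = 2 ∨ b = 3) ∧ (a = 2 ∨ b = 2) := by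
      simp only [edgesII, Set.mem_insert_iff, Set.mem_singleton_iff, Prod.mk.injEq] at h
      omega
    refine ⟨by omega, by omega, by omega, by omega, fun c hca hcb => ?_⟩
    rcases c with _ | _ | c
    · simp at hca
    · rcases h'.2.2 with h | h <;> subst h <;> simp at hca hcb
    · have : 2 ^ 2 ≤ 2 ^ (c + 1 + 1) := Nat.pow_le_pow_right (by norm_num) (by omega)
      rw [Nat.div_eq_of_lt (by omega), Nat.div_eq_of_lt (by omega)]
  | succ m hm ih =>
    intro a b h
    obtain ⟨k, rfl⟩ : ∃ k, m = k + 2 := ⟨m - 2, by omega⟩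
    have hp : 2 ^ (k + 2 + 1) = 2 ^ (k + 2) + 2 ^ (k + 2) := by ring
    have hpos : 2 ≤ 2 ^ (k + 2) := by rw [pow_add]; have : 0 < 2 ^ k := by positivity
                                      omega
    have fin : ∀ a b : ℕ, a < 2 ^ (k + 2 + 1) → b < 2 ^ (k + 2 + 1) →
        (∀ c, c ≤ k + 2 → ¬ 2 ^ c ∣ a → ¬ 2 ^ c ∣ b → a / 2 ^ c = b / 2 ^ c) →
        ∀ c, ¬ 2 ^ c ∣ a → ¬ 2 ^ c ∣ b → a / 2 ^ c = b / 2 ^ c := by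
      intro a b ha hb hh c hca hcb
      rcases le_or_gt c (k + 2) with h | h
      · exact hh c h hca hcb
      · have : 2 ^ (k + 2 + 1) ≤ 2 ^ c := Nat.pow_le_pow_right (by norm_num) h
        rw [Nat.div_eq_of_lt (by omega), Nat.div_eq_of_lt (by omega)]
    have finA : ∀ b : ℕ, 
        (∀ c, c ≤ k + 2 → ¬ 2 ^ c ∣ 2 ^ (k + 2) → ¬ 2 ^ c ∣ b →
          2 ^ (k + 2) / 2 ^ c = b / 2 ^ c) := 
      fun b c hc h _ => absurd (pow_dvd_pow 2 hc) h
    have finB : ∀ a : ℕ, 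
        (∀ c, c ≤ k + 2 → ¬ 2 ^ c ∣ a → ¬ 2 ^ c ∣ 2 ^ (k + 2) → 
          a / 2 ^ c = 2 ^ (k + 2) / 2 ^ c) := 
      fun b c hc _ h => absurd (pow_dvd_pow 2 hc) h
    rw [edgesII] at h
    rcases h with (((h | h) | h) | h) | h
    · obtain ⟨h1, h2, h3, h4, h5⟩ := ih a b h
      exact ⟨h1, by omega, h3, by omega, h5⟩
    · obtain ⟨⟨a', b'⟩, h, he⟩ := h
      obtain ⟨h1, h2, h3, h4, h5⟩ := ih a' b' h
      simp only [Prod.mk.injEq] at he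
      obtain ⟨rfl, rfl⟩ := he
      refine ⟨by omega, by omega, by omega, by omega, fin _ _ (by omega) (by omega) ?_⟩
      intro c hc hca hcb
      have hd : 2 ^ c ∣ 2 ^ (k + 2) := pow_dvd_pow 2 hc
      rw [Nat.dvd_add_left hd] at hca hcb
      rw [Nat.add_div_of_dvd_left hd, Nat.add_div_of_dvd_left hd, h5 c hca hcb]
    · simp only [Set.mem_insert_iff, Set.mem_singleton_iff, Prod.mk.injEq] at h
      rcases h with ⟨rfl, rfl⟩ | ⟨rfl, rfl⟩
      · exact ⟨by omega, by omega, by omega, by omega,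
          fin _ _ (by omega) (by omega) (finB _)⟩
      · exact ⟨by omega, by omega, by omega, by omega,
          fin _ _ (by omega) (by omega) (finA _)⟩
    · obtain ⟨j, hj1, hj2, he⟩ := h
      simp only [Prod.mk.injEq] at he
      obtain ⟨rfl, rfl⟩ := he
      exact ⟨by omega, by omega, by omega, by omega,
          fin _ _ (by omega) (by omega) (finA _)⟩
    · obtain ⟨j, hj1, hj2, he⟩ := h
      simp only [Prod.mk.injEq] at he
      obtain ⟨rfl, rfl⟩ := he
      exact ⟨by omega, by omega, by omega, by omega,
          fin _ _ (by omega) (by omega) (finB _)⟩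

lemma aux_path_sub (n : ℕ) (hn : 2 ≤ n) : ∀ i, 1 ≤ i → i + 1 < 2 ^ n →
    (i, i + 1) ∈ edgesII n := by
  induction n, hn using Nat.le_induction with
  | base =>
    intro i h1 h2
    have : i = 1 ∨ i = 2 := by omega
    rcases this with rfl | rfl <;> simp [edgesII]
  | succ m hm ih =>
    intro i h1 h2
    obtain ⟨k, rfl⟩ : ∃ k, m = k + 2 := ⟨m - 2, by omega⟩
    have hp : 2 ^ (k + 2 + 1) = 2 ^ (k + 2) + 2 ^ (k + 2) := by ring
    rw [edgesII]
    have : i + 1 < 2 ^ (k + 2) ∨ i + 1 = 2 ^ (k + 2) ∨ i = 2 ^ (k + 2) ∨ 2 ^ (k + 2) < i := by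
      omega
    rcases this with h | h | h | h
    · exact Or.inl (Or.inl (Or.inl (Or.inl (ih i h1 h))))
    · refine Or.inl (Or.inl (Or.inr (Or.inl ?_)))
      simp only [Prod.mk.injEq]; omega
    · refine Or.inl (Or.inl (Or.inr (Or.inr ?_)))
      simp only [Set.mem_singleton_iff, Prod.mk.injEq]; omega
    · refine Or.inl (Or.inl (Or.inl (Or.inr ⟨_, ih (i - 2 ^ (k + 2)) (by omega) (by omega), ?_⟩)))
      simp only [Prod.mk.injEq]; omega

lemma aux_block (R : ℕ → ℕ → Prop) (c : ℕ)
    (hR : ∀ a b, R a b → ¬ 2 ^ c ∣ a → ¬ 2 ^ c ∣ b → a / 2 ^ c = b / 2 ^ c) :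
    ∀ (l : List ℕ) (u v : ℕ), l.head? = some u → l.getLast? = some v → l.IsChain R →
      (∀ x ∈ l, ¬ 2 ^ c ∣ x) → u / 2 ^ c = v / 2 ^ c := by
  intro l
  induction l with
  | nil => intro u v h; simp at h
  | cons a t ih =>
    intro u v hu hv hc hx
    simp only [List.head?_cons, Option.some.injEq] at hu
    subst hu
    cases t with
    | nil => simp at hv; rw [hv]
    | cons b t =>
      rw [List.isChain_cons_cons] at hc
      rw [hR a b hc.1 (hx _ (by simp)) (hx _ (by simp))]
      exact ih b v (by simp) (by simpa using hv) hc.2 (fun x h => hx x (by simp_all))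

lemma aux_same (c u v : ℕ) (hu : 2 ^ c ∣ u) (hv : 2 ^ c ∣ v) (hu' : ¬ 2 ^ (c + 1) ∣ u)
    (hv' : ¬ 2 ^ (c + 1) ∣ v) (h : u / 2 ^ (c + 1) = v / 2 ^ (c + 1)) : u = v := by
  obtain ⟨s, rfl⟩ := hu
  obtain ⟨t, rfl⟩ := hv
  have hpos : 0 < 2 ^ c := by positivity
  rw [pow_succ, Nat.mul_dvd_mul_iff_left hpos] at hu' hv'
  rw [pow_succ, Nat.mul_div_mul_left _ _ hpos, Nat.mul_div_mul_left _ _ hpos] at h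
  congr 1
  omega

lemma aux_std_ranking (n : ℕ) (hn : 2 ≤ n) : IsRanking (GII n) n stdLabel := by
  refine ⟨fun v hv => ?_, fun u hu v hv hne he l hl => ?_⟩
  · obtain ⟨h1, h2⟩ := hv
    refine ⟨by simp [stdLabel], (aux_std_le v n (by omega)).2 fun hd => ?_⟩
    have := Nat.le_of_dvd (by omega) hd
    have : 0 < 2 ^ n := by positivity
    omega
  · by_contra hcon
    push Not at hcon
    obtain ⟨l1, l2, l3, l4⟩ := hl
    have hu0 : u ≠ 0 := by have := hu.1; omega
    have hv0 : v ≠ 0 := by have := hv.1; omega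
    have hb := aux_block _ (stdLabel u)
      (fun a b hab => (aux_edges n hn a b hab).2.2.2.2 (stdLabel u)) l u v l1 l2 l3
      (fun x hx => (aux_std_le x _ (by have := (l4 x hx).1; omega)).1 (hcon x hx))
    apply hne
    refine aux_same (padicValNat 2 u) u v ?_ ?_ ?_ ?_ hb
    · exact pow_padicValNat_dvd
    · have : padicValNat 2 u = padicValNat 2 v := by simpa [stdLabel] using he
      rw [this]; exact pow_padicValNat_dvd
    · exact (aux_std_le u _ hu0).1 le_rfl
    · exact (aux_std_le v _ hv0).1 he.ge

lemma aux_to_path (n : ℕ) (hn : 2 ≤ n) (k : ℕ) (f : ℕ → ℕ) (h : IsRanking (GII n) k f) :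
    IsRanking (pathP (2 ^ n - 1)) k f := by
  refine ⟨h.1, fun u hu v hv hne he l hl => h.2 u hu v hv hne he l ?_⟩
  refine ⟨hl.1, hl.2.1, hl.2.2.1.imp ?_, hl.2.2.2⟩
  rintro a b ⟨i, hi1, hi2, hi⟩
  simp only [Prod.mk.injEq] at hi
  obtain ⟨rfl, rfl⟩ := hi
  exact aux_path_sub n hn a hi1 (by omega)

lemma aux_path_rank (L k : ℕ) (f : ℕ → ℕ) (h : IsRanking (pathP L) k f) :
    L + 1 ≤ 2 ^ k ∧ (L + 1 = 2 ^ k → ∀ i, 1 ≤ i → i ≤ L → f i = stdLabel i) := by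
  have := aux_path k 0 L f (fun i h1 h2 => by rw [zero_add]; exact h.1 i ⟨h1, h2⟩)
    (fun i j hi hij hj he => by
      simp only [zero_add] at he
      simp only [zero_add]
      have hw : IsWalkFrom (pathP L) i j (List.range' i (j - i + 1)) := by
        refine ⟨?_, ?_, ?_, ?_⟩
        · rw [List.range'_succ, List.head?_cons]
        · rw [List.getLast?_range']; simp; omega
        · rw [List.Chain', List.isChain_iff_getElem]
          intro t ht
          simp only [List.length_range'] at ht
          simp only [List.getElem_range', pathP, pathEdges, Set.mem_setOf_eq, Prod.mk.injEq]
          exact ⟨i + t, by omega, by omega, by omega, by omega⟩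
        · intro x hx
          simp only [List.mem_range'_1] at hx
          exact ⟨by omega, by omega⟩
      obtain ⟨x, hx, hlt⟩ := h.2 i ⟨hi, by omega⟩ j ⟨by omega, hj⟩ (by omega) he _ hw
      simp only [List.mem_range'_1] at hx
      exact ⟨x, hx.1, by omega, hlt⟩)
  simpa using this

lemma aux_rn (G : DGraph) (n : ℕ) (f : ℕ → ℕ) (h : IsRanking G n f)
    (h' : ∀ k g, IsRanking G k g → n ≤ k) : rankNumber G = n := by
  apply le_antisymm
  · exact Nat.sInf_le ⟨f, h⟩
  · exact le_csInf ⟨n, f, h⟩ (fun k ⟨g, hg⟩ => h' k g hg)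

/-- For `n ≥ 2`, `χ_r(←G_n) = χ_r(→P_{2^n−1}) = n`, and `←G_n` has a
unique minimal ranking, which coincides with the standard minimal ranking of
`→P_{2^n−1}`. -/
theorem stmt_6 (n : ℕ) (hn : 2 ≤ n) :
    rankNumber (GII n) = n ∧ rankNumber (pathP (2 ^ n - 1)) = n ∧
    IsRanking (GII n) n stdLabel ∧
    ∀ f : ℕ → ℕ, IsRanking (GII n) n f → ∀ v ∈ (GII n).verts, f v = stdLabel v := by
  have hpos : 0 < 2 ^ n := by positivity
  have hstd := aux_std_ranking n hn
  have hlow : ∀ k g, IsRanking (pathP (2 ^ n - 1)) k g → n ≤ k := by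
    intro k g hg
    have := (aux_path_rank _ k g hg).1
    rw [Nat.sub_add_cancel hpos] at this
    exact (Nat.pow_le_pow_iff_right (by norm_num)).1 this
  refine ⟨aux_rn _ n _ hstd fun k g hg => hlow k g (aux_to_path n hn k g hg),
    aux_rn _ n _ (aux_to_path n hn n _ hstd) hlow, hstd, fun f hf v hv => ?_⟩
  exact (aux_path_rank _ n f (aux_to_path n hn n f hf)).2 (by omega) v hv.1 hv.2
end
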